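/- (Theorem 1, matrix formalization.) Fix reals γ_h, γ_u, γ_v, γ_Q > 0, sequences H, U, V : ℕ → ℂ with |H_i| ≤ γ_h, |U_i| ≤ γ_u, |V_i| ≤ γ_v for all i, bounds γ_i ∈ (0, γ_Q], and a function α : ℕ → [0,∞) with α(n)/√n → 0 as n → ∞. Define ψ^o(n) := inf_{Q ∈ 𝒬^{α(n)}(n)} ‖T_n Φ(Q)‖ and μ_M := inf{ ‖diag(H_1,…,H_M) − diag(U_1,…,U_M)·Z·diag(V_1,…,V_M)‖ : Z an M×M complex matrix with |Z_{ii}| ≤ γ_i }. Then lim_{n→∞} ψ^o(n) exists and equals μ^o := lim_{M→∞} μ_M = sup_M μ_M. -/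

import Mathlib

/-- The ℓ²→ℓ² operator norm of a complex matrix. -/
noncomputable def l2opNorm {m n : Type*} [Fintype m] [Fintype n] [DecidableEq n]
    (A : Matrix m n ℂ) : ℝ :=
  ‖LinearMap.toContinuousLinearMap (Matrix.toEuclideanLin A)‖

/-- The constraint set `𝒬^α(n)`: α-column diagonally dominant matrices with `|Q_{ii}| ≤ γ i`. -/
def QSet (n : ℕ) (α : ℝ) (γ : ℕ → ℝ) : Set (Matrix (Fin n) (Fin n) ℂ) :=
  {Q | (∀ j, ∑ i ∈ Finset.univ.erase j, ‖Q i j‖ ≤ α * ‖Q j j‖) ∧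
       ∀ i, ‖Q i i‖ ≤ γ (i : ℕ)}

/-- The closed-loop map `Φ(Q) = diag H − diag U ⬝ Q ⬝ diag V`. -/
noncomputable def PhiMat (n : ℕ) (H U V : ℕ → ℂ) (Q : Matrix (Fin n) (Fin n) ℂ) :
    Matrix (Fin n) (Fin n) ℂ :=
  Matrix.diagonal (fun i : Fin n => H i) -
    Matrix.diagonal (fun i : Fin n => U i) * Q * Matrix.diagonal (fun i : Fin n => V i)

/-- The deviation-from-average matrix `T_n = I_n − (1/n) 𝟙𝟙ᵀ`. -/
noncomputable def Tmat (n : ℕ) : Matrix (Fin n) (Fin n) ℂ :=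
  1 - ((n : ℂ)⁻¹) • Matrix.of (fun _ _ : Fin n => (1 : ℂ))

/-- `μ_M`: the optimal value of the decentralized `M`-agent model-matching problem. -/
noncomputable def muSeq (H U V : ℕ → ℂ) (γ : ℕ → ℝ) (M : ℕ) : ℝ :=
  sInf {r : ℝ | ∃ Z : Matrix (Fin M) (Fin M) ℂ, (∀ i, ‖Z i i‖ ≤ γ (i : ℕ)) ∧
    r = l2opNorm (Matrix.diagonal (fun i : Fin M => H i) -
      Matrix.diagonal (fun i : Fin M => U i) * Z * Matrix.diagonal (fun i : Fin M => V i))}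

section Helpers
open scoped Matrix.Norms.L2Operator
open Matrix

lemma l2opNorm_eq {m n : Type*} [Fintype m] [Fintype n] [DecidableEq n]
    (A : Matrix m n ℂ) : l2opNorm A = ‖A‖ := rfl

lemma norm_submatrix_le_aux {m n : Type*} [Fintype m] [Fintype n] [DecidableEq n] [DecidableEq m]
    (A : Matrix n n ℂ) (e : m → n) (he : Function.Injective e) : ‖A.submatrix e e‖ ≤ ‖A‖ := by
  set E : Matrix n m ℂ := (1 : Matrix n n ℂ).submatrix id e with hE
  have h1 : Eᴴ * E = 1 := by
    ext i j
    simp [hE, Matrix.mul_apply, Matrix.one_apply, he.eq_iff, apply_ite]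
  have h2 : A.submatrix e e = Eᴴ * A * E := by
    ext i j
    simp [hE, Matrix.mul_apply, Matrix.one_apply, apply_ite]
  have hone : ‖(1 : Matrix m m ℂ)‖ ≤ 1 := by
    rw [← Matrix.diagonal_one, Matrix.l2_opNorm_diagonal]
    exact (pi_norm_le_iff_of_nonneg zero_le_one).2 fun i => by simp
  have h3 : ‖E‖ ≤ 1 := by
    have := Matrix.l2_opNorm_conjTranspose_mul_self E
    rw [h1] at this
    nlinarith [norm_nonneg E]
  have h4 : ‖Eᴴ‖ ≤ 1 := by rw [Matrix.l2_opNorm_conjTranspose]; exact h3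
  rw [h2]
  calc ‖Eᴴ * A * E‖ ≤ ‖Eᴴ * A‖ * ‖E‖ := Matrix.l2_opNorm_mul _ _
    _ ≤ (‖Eᴴ‖ * ‖A‖) * ‖E‖ := by gcongr; exact Matrix.l2_opNorm_mul _ _
    _ ≤ (1 * ‖A‖) * 1 := by gcongr
    _ = ‖A‖ := by ring

lemma norm_diag_entry_le_aux {n : Type*} [Fintype n] [DecidableEq n]
    (A : Matrix n n ℂ) (i : n) : ‖A i i‖ ≤ ‖A‖ := by
  have h := norm_submatrix_le_aux A (fun _ : Unit => i) (fun _ _ _ => rfl)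
  have h2 : A.submatrix (fun _ : Unit => i) (fun _ : Unit => i)
      = Matrix.diagonal (fun _ => A i i) := by
    ext a b
    simp
  rw [h2, Matrix.l2_opNorm_diagonal] at h
  exact (norm_le_pi_norm (fun _ : Unit => A i i) ()).trans h

lemma norm_Tmat_le_aux (n : ℕ) : ‖Tmat n‖ ≤ 1 := by
  have h1 : (Tmat n)ᴴ * Tmat n = Tmat n := by
    have hs : (Tmat n)ᴴ = Tmat n := by
      ext i j
      simp [Tmat, Matrix.one_apply, eq_comm, apply_ite]
    rw [hs]
    have hJ : (Matrix.of (fun _ _ : Fin n => (1 : ℂ))) * (Matrix.of (fun _ _ : Fin n => (1 : ℂ)))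
        = (n : ℂ) • Matrix.of (fun _ _ : Fin n => (1 : ℂ)) := by
      ext i j
      simp [Matrix.mul_apply]
    rcases Nat.eq_zero_or_pos n with h0 | h0
    · subst h0
      ext i
      exact i.elim0
    · have hn : (n : ℂ) ≠ 0 := by exact_mod_cast h0.ne'
      unfold Tmat
      rw [mul_sub, sub_mul, sub_mul, smul_mul_smul_comm, hJ, smul_smul]
      have : (n : ℂ)⁻¹ * (n : ℂ)⁻¹ * n = (n : ℂ)⁻¹ := by field_simp
      rw [this]
      simp
  have h2 := Matrix.l2_opNorm_conjTranspose_mul_self (Tmat n)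
  rw [h1] at h2
  by_contra hc
  nlinarith

lemma PhiMat_apply_aux (n : ℕ) (H U V : ℕ → ℂ) (Q : Matrix (Fin n) (Fin n) ℂ) (i j : Fin n) :
    PhiMat n H U V Q i j = (if i = j then H i else 0) - U i * Q i j * V j := by
  simp [PhiMat, Matrix.diagonal_apply]

lemma muSeq_eq_aux (H U V : ℕ → ℂ) (γ : ℕ → ℝ) (M : ℕ) :
    muSeq H U V γ M = sInf {r : ℝ | ∃ Z : Matrix (Fin M) (Fin M) ℂ, (∀ i, ‖Z i i‖ ≤ γ (i : ℕ)) ∧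
      r = ‖PhiMat M H U V Z‖} := rfl

lemma muSeq_le_aux (H U V : ℕ → ℂ) (γ : ℕ → ℝ) (M : ℕ) (Z : Matrix (Fin M) (Fin M) ℂ)
    (hZ : ∀ i, ‖Z i i‖ ≤ γ (i : ℕ)) : muSeq H U V γ M ≤ ‖PhiMat M H U V Z‖ := by
  rw [muSeq_eq_aux]
  refine csInf_le ⟨0, ?_⟩ ⟨Z, hZ, rfl⟩
  rintro r ⟨Z, -, rfl⟩
  exact norm_nonneg _

/-- the upper bound -/
lemma psi_le_muSeq_aux (H U V : ℕ → ℂ) (γ : ℕ → ℝ) (hγ : ∀ i, 0 < γ i) (a : ℝ) (ha : 0 ≤ a)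
    (n : ℕ) :
    sInf {r : ℝ | ∃ Q ∈ QSet n a γ, r = l2opNorm (Tmat n * PhiMat n H U V Q)}
      ≤ muSeq H U V γ n := by
  rw [muSeq_eq_aux]
  refine le_csInf ⟨_, 0, fun i => by simpa using (hγ i).le, rfl⟩ ?_
  rintro r ⟨Z, hZ, rfl⟩
  have hmem : Matrix.diagonal (fun i => Z i i) ∈ QSet n a γ := by
    refine ⟨fun j => ?_, fun i => by simpa using hZ i⟩
    rw [Finset.sum_eq_zero]
    · positivity
    · intro i hi
      rw [Matrix.diagonal_apply_ne _ (Finset.ne_of_mem_erase hi), norm_zero]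
  have h1 : l2opNorm (Tmat n * PhiMat n H U V (Matrix.diagonal (fun i => Z i i)))
      ≤ ‖PhiMat n H U V Z‖ := by
    rw [l2opNorm_eq]
    have hd : PhiMat n H U V (Matrix.diagonal (fun i => Z i i))
        = Matrix.diagonal (fun i => PhiMat n H U V Z i i) := by
      ext i j
      rw [PhiMat_apply_aux]
      by_cases hij : i = j
      · subst hij
        simp [PhiMat_apply_aux]
      · simp [hij]
    have hd2 : ‖PhiMat n H U V (Matrix.diagonal (fun i => Z i i))‖ ≤ ‖PhiMat n H U V Z‖ := by
      rw [hd, Matrix.l2_opNorm_diagonal]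
      exact (pi_norm_le_iff_of_nonneg (norm_nonneg _)).2 fun i => norm_diag_entry_le_aux _ i
    calc ‖Tmat n * PhiMat n H U V (Matrix.diagonal (fun i => Z i i))‖
        ≤ ‖Tmat n‖ * ‖PhiMat n H U V (Matrix.diagonal (fun i => Z i i))‖ :=
          Matrix.l2_opNorm_mul _ _
      _ ≤ 1 * ‖PhiMat n H U V Z‖ :=
          mul_le_mul (norm_Tmat_le_aux n) hd2 (norm_nonneg _) zero_le_one
      _ = _ := one_mul _
  refine le_trans (csInf_le ⟨0, ?_⟩ ⟨_, hmem, rfl⟩) h1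
  rintro r ⟨Q, -, rfl⟩
  exact norm_nonneg _

lemma col_sum_aux (γh γu γv γQ : ℝ) (hγh : 0 < γh) (hγu : 0 < γu) (hγv : 0 < γv)
    (H U V : ℕ → ℂ)
    (hH : ∀ i, ‖H i‖ ≤ γh) (hU : ∀ i, ‖U i‖ ≤ γu) (hV : ∀ i, ‖V i‖ ≤ γv)
    (γ : ℕ → ℝ) (hγQ' : ∀ i, γ i ≤ γQ) (a : ℝ) (ha : 0 ≤ a) (n : ℕ)
    (Q : Matrix (Fin n) (Fin n) ℂ) (hQ : Q ∈ QSet n a γ) (j : Fin n) :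
    ‖∑ i, PhiMat n H U V Q i j‖ ≤ γh + γu * ((1 + a) * γQ) * γv := by
  simp only [PhiMat_apply_aux, Finset.sum_sub_distrib, Finset.sum_ite_eq', Finset.mem_univ,
    if_true]
  refine (norm_sub_le _ _).trans (add_le_add (hH _) ?_)
  have hsum : ∑ i, ‖Q i j‖ ≤ (1 + a) * γQ := by
    rw [← Finset.add_sum_erase _ _ (Finset.mem_univ j)]
    have h1 := hQ.1 j
    have h2 : ‖Q j j‖ ≤ γQ := (hQ.2 j).trans (hγQ' _)
    nlinarith [mul_le_mul_of_nonneg_left h2 ha]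
  calc ‖∑ i : Fin n, U i * Q i j * V j‖ ≤ ∑ i : Fin n, ‖U i * Q i j * V j‖ := norm_sum_le _ _
    _ ≤ ∑ i, γu * ‖Q i j‖ * γv := by
        refine Finset.sum_le_sum fun i _ => ?_
        rw [norm_mul, norm_mul]
        gcongr
        · exact hU _
        · exact hV _
    _ = γu * (∑ i, ‖Q i j‖) * γv := by rw [Finset.mul_sum, Finset.sum_mul]
    _ ≤ _ := by gcongr

/-- the lower bound -/
lemma muSeq_le_psi_aux (γh γu γv γQ : ℝ) (hγh : 0 < γh) (hγu : 0 < γu) (hγv : 0 < γv)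
    (hγQ : 0 < γQ) (H U V : ℕ → ℂ)
    (hH : ∀ i, ‖H i‖ ≤ γh) (hU : ∀ i, ‖U i‖ ≤ γu) (hV : ∀ i, ‖V i‖ ≤ γv)
    (γ : ℕ → ℝ) (hγ : ∀ i, 0 < γ i) (hγQ' : ∀ i, γ i ≤ γQ) (a : ℝ) (ha : 0 ≤ a) (M n : ℕ)
    (hMn : M ≤ n) :
    muSeq H U V γ M - ‖Matrix.of (fun _ _ : Fin M => (1 : ℂ))‖ *
        ((n : ℝ)⁻¹ * (γh + γu * ((1 + a) * γQ) * γv))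
      ≤ sInf {r : ℝ | ∃ Q ∈ QSet n a γ, r = l2opNorm (Tmat n * PhiMat n H U V Q)} := by
  refine le_csInf ⟨_, 0, ⟨fun j => by simp, fun i => by simpa using (hγ i).le⟩, rfl⟩ ?_
  rintro r ⟨Q, hQ, rfl⟩
  rw [l2opNorm_eq]
  set e : Fin M → Fin n := Fin.castLE hMn with he
  have hinj : Function.Injective e := Fin.castLE_injective hMn
  set c : Fin M → ℂ := fun j => (n : ℂ)⁻¹ * ∑ i, PhiMat n H U V Q i (e j) with hc
  have hcn : ‖c‖ ≤ (n : ℝ)⁻¹ * (γh + γu * ((1 + a) * γQ) * γv) := by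
    refine (pi_norm_le_iff_of_nonneg (by positivity)).2 fun j => ?_
    simp only [hc, norm_mul, norm_inv, Complex.norm_natCast]
    gcongr
    exact col_sum_aux γh γu γv γQ hγh hγu hγv H U V hH hU hV γ hγQ' a ha n Q hQ _
  have hsub : PhiMat M H U V (Q.submatrix e e)
      = (Tmat n * PhiMat n H U V Q).submatrix e e
        + Matrix.of (fun _ _ : Fin M => (1 : ℂ)) * Matrix.diagonal c := by
    ext i j
    have h1 : (Tmat n * PhiMat n H U V Q) (e i) (e j)
        = PhiMat n H U V Q (e i) (e j) - c j := by
      rw [Tmat, sub_mul, one_mul, Matrix.sub_apply, Matrix.smul_mul, Matrix.smul_apply,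
        Matrix.mul_apply]
      simp [hc]
    rw [Matrix.add_apply, Matrix.submatrix_apply, h1, Matrix.mul_diagonal]
    simp [PhiMat_apply_aux, hinj.eq_iff]
    simp [he]
  have h1 := muSeq_le_aux H U V γ M (Q.submatrix e e) (fun i => hQ.2 (e i))
  have h2 : ‖PhiMat M H U V (Q.submatrix e e)‖ ≤ ‖Tmat n * PhiMat n H U V Q‖
      + ‖Matrix.of (fun _ _ : Fin M => (1 : ℂ))‖ *
        ((n : ℝ)⁻¹ * (γh + γu * ((1 + a) * γQ) * γv)) := by
    rw [hsub]
    refine (norm_add_le _ _).trans (add_le_add (norm_submatrix_le_aux _ e hinj) ?_)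
    refine (Matrix.l2_opNorm_mul _ _).trans ?_
    rw [Matrix.l2_opNorm_diagonal]
    gcongr
  linarith

lemma muSeq_bdd_aux (γh : ℝ) (hγh : 0 < γh) (H U V : ℕ → ℂ) (hH : ∀ i, ‖H i‖ ≤ γh)
    (γ : ℕ → ℝ) (hγ : ∀ i, 0 < γ i) : BddAbove (Set.range (muSeq H U V γ)) := by
  refine ⟨γh, ?_⟩
  rintro _ ⟨M, rfl⟩
  refine (muSeq_le_aux H U V γ M 0 (fun i => by simpa using (hγ i).le)).trans ?_
  have : PhiMat M H U V 0 = Matrix.diagonal (fun i : Fin M => H i) := by simp [PhiMat]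
  rw [this, Matrix.l2_opNorm_diagonal]
  exact (pi_norm_le_iff_of_nonneg hγh.le).2 fun i => hH i

lemma err_tendsto_aux (K A B C : ℝ) (α : ℕ → ℝ)
    (hαn : Filter.Tendsto (fun n => α n / Real.sqrt n) Filter.atTop (nhds 0)) :
    Filter.Tendsto (fun n : ℕ => K * ((n : ℝ)⁻¹ * (A + B * ((1 + α n) * C)  * 1)))
      Filter.atTop (nhds 0) := by
  have h0 : Filter.Tendsto (fun n : ℕ => ((n : ℝ))⁻¹) Filter.atTop (nhds 0) :=
    tendsto_inv_atTop_nhds_zero_nat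
  have h1 : Filter.Tendsto (fun n : ℕ => (Real.sqrt n)⁻¹) Filter.atTop (nhds 0) :=
    (Real.tendsto_sqrt_atTop.comp tendsto_natCast_atTop_atTop).inv_tendsto_atTop
  have h2 := ((h0.const_mul (K * (A + B * C))).add ((hαn.mul h1).const_mul (K * B * C)))
  simp only [mul_zero, add_zero] at h2
  refine h2.congr fun n => ?_
  have h3 : α n / Real.sqrt n * (Real.sqrt n)⁻¹ = α n * (n : ℝ)⁻¹ := by
    rw [div_eq_mul_inv, mul_assoc, ← mul_inv, Real.mul_self_sqrt (Nat.cast_nonneg n)]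
  rw [h3]
  ring

end Helpers

/-- Theorem 1: with `α(n)/√n → 0`, the optimal social cost
`ψ^o(n) = inf_{Q ∈ 𝒬^{α(n)}(n)} ‖T_n Φ(Q)‖` converges, as `n → ∞`, to
`μ^o = lim_M μ_M = sup_M μ_M`. -/
theorem decentralized_selfish_optimal_Hinf
    (γh γu γv γQ : ℝ) (hγh : 0 < γh) (hγu : 0 < γu) (hγv : 0 < γv) (hγQ : 0 < γQ)
    (H U V : ℕ → ℂ)
    (hH : ∀ i, ‖H i‖ ≤ γh) (hU : ∀ i, ‖U i‖ ≤ γu)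
    (hV : ∀ i, ‖V i‖ ≤ γv)
    (γ : ℕ → ℝ) (hγ : ∀ i, 0 < γ i) (hγQ' : ∀ i, γ i ≤ γQ)
    (α : ℕ → ℝ) (hα : ∀ n, 0 ≤ α n)
    (hαn : Filter.Tendsto (fun n => α n / Real.sqrt n) Filter.atTop (nhds 0)) :
    Filter.Tendsto
      (fun n => sInf {r : ℝ | ∃ Q ∈ QSet n (α n) γ,
        r = l2opNorm (Tmat n * PhiMat n H U V Q)})
      Filter.atTop (nhds (⨆ M, muSeq H U V γ M)) := by
  have hbdd := muSeq_bdd_aux γh hγh H U V hH γ hγ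
  rw [tendsto_order]
  constructor
  · intro b hb
    obtain ⟨M, hM⟩ := exists_lt_of_lt_ciSup hb
    have herr := err_tendsto_aux (l2opNorm (Matrix.of (fun _ _ : Fin M => (1 : ℂ)))) γh
      (γu * γv) γQ α hαn
    have hev := herr.eventually (gt_mem_nhds (sub_pos.2 hM))
    filter_upwards [hev, Filter.eventually_ge_atTop M] with n hn hMn
    have h := muSeq_le_psi_aux γh γu γv γQ hγh hγu hγv hγQ H U V hH hU hV γ hγ hγQ'
      (α n) (hα n) M n hMn
    rw [← l2opNorm_eq] at h
    have e : γu * γv * ((1 + α n) * γQ) * 1 = γu * ((1 + α n) * γQ) * γv := by ring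
    rw [e] at hn
    linarith
  · intro b hb
    refine Filter.Eventually.of_forall fun n => ?_
    exact ((psi_le_muSeq_aux H U V γ hγ (α n) (hα n) n).trans (le_ciSup hbdd n)).trans_lt hb
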